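/- Suppose G : [0,∞) → [0,∞) is continuous, bounded and strictly positive definite. If μ* ∈ Ξ(x) minimizes the cost functional C over Ξ(x), then there exists a constant λ ∈ ℝ such that ∫₀ᵗ h(s) ds + ∫_{[0,T]} G(|t-s|) dμ*(s) - 2φ ∫₀ᵗ X^{μ*}_s ds = λ for all t ∈ [0,T]. -/

import Mathlib

open MeasureTheory

/-- Integral of a real function against a finite signed Borel measure,
via its Jordan decomposition. -/
noncomputable def sint (ν : SignedMeasure ℝ) (f : ℝ → ℝ) : ℝ :=
  (∫ t, f t ∂ν.toJordanDecomposition.posPart) -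
    ∫ t, f t ∂ν.toJordanDecomposition.negPart

/-- The set Ξ(x) of deterministic admissible strategies: finite signed Borel
measures supported in `[0,T]` with total mass `-x`. -/
def Xi (T x : ℝ) : Set (SignedMeasure ℝ) :=
  {μ | (∀ s : Set ℝ, s ∩ Set.Icc 0 T = ∅ → μ s = 0) ∧ μ Set.univ = -x}

def BC (f : ℝ → ℝ) : Prop := Continuous f ∧ ∃ M : ℝ, ∀ t, |f t| ≤ M

lemma BC.integrable {f : ℝ → ℝ} (hf : BC f) (ρ : Measure ℝ) [IsFiniteMeasure ρ] :
    Integrable f ρ := by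
  obtain ⟨hc, M, hM⟩ := hf
  exact Integrable.of_bound hc.aestronglyMeasurable M (Filter.Eventually.of_forall hM)

lemma BC.lin {f g : ℝ → ℝ} (hf : BC f) (hg : BC g) (c : ℝ) : BC (fun t => f t + c * g t) := by
  obtain ⟨hc, M, hM⟩ := hf
  obtain ⟨hc', M', hM'⟩ := hg
  refine ⟨by fun_prop, M + |c| * M', fun t => ?_⟩
  calc |f t + c * g t| ≤ |f t| + |c * g t| := abs_add_le _ _
    _ = |f t| + |c| * |g t| := by rw [abs_mul]
    _ ≤ _ := by gcongr <;> [exact hM t; exact hM' t]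

lemma jordan_sub (ν : SignedMeasure ℝ) :
    ν = ν.toJordanDecomposition.posPart.toSignedMeasure -
      ν.toJordanDecomposition.negPart.toSignedMeasure :=
  (ν.toSignedMeasure_toJordanDecomposition).symm

lemma sint_of (ν : SignedMeasure ℝ) (ρ₁ ρ₂ : Measure ℝ) [IsFiniteMeasure ρ₁] [IsFiniteMeasure ρ₂]
    (hν : ν = ρ₁.toSignedMeasure - ρ₂.toSignedMeasure) {f : ℝ → ℝ} (hf : BC f) :
    sint ν f = (∫ t, f t ∂ρ₁) - ∫ t, f t ∂ρ₂ := by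
  have h1 := jordan_sub ν
  have h2 : ν.toJordanDecomposition.posPart + ρ₂ = ν.toJordanDecomposition.negPart + ρ₁ := by
    rw [← Measure.toSignedMeasure_eq_toSignedMeasure_iff, Measure.toSignedMeasure_add,
      Measure.toSignedMeasure_add]
    have h3 := h1.symm.trans hν
    rw [sub_eq_sub_iff_add_eq_add] at h3
    rw [h3, add_comm]
  have h4 : ∫ t, f t ∂(ν.toJordanDecomposition.posPart + ρ₂)
      = ∫ t, f t ∂(ν.toJordanDecomposition.negPart + ρ₁) := by rw [h2]
  rw [integral_add_measure (hf.integrable _) (hf.integrable _),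
    integral_add_measure (hf.integrable _) (hf.integrable _)] at h4
  unfold sint
  linarith

lemma sint_add (a b : SignedMeasure ℝ) {f : ℝ → ℝ} (hf : BC f) :
    sint (a + b) f = sint a f + sint b f := by
  rw [sint_of (a + b) (a.toJordanDecomposition.posPart + b.toJordanDecomposition.posPart)
    (a.toJordanDecomposition.negPart + b.toJordanDecomposition.negPart) ?_ hf,
    integral_add_measure (hf.integrable _) (hf.integrable _),
    integral_add_measure (hf.integrable _) (hf.integrable _)]
  · unfold sint; ring
  · rw [Measure.toSignedMeasure_add, Measure.toSignedMeasure_add]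
    conv_lhs => rw [jordan_sub a, jordan_sub b]
    abel

lemma sint_smul (c : ℝ) (a : SignedMeasure ℝ) (f : ℝ → ℝ) :
    sint (c • a) f = c * sint a f := by
  unfold sint
  rw [SignedMeasure.toJordanDecomposition_smul_real]
  rcases le_or_gt 0 c with hc | hc
  · rw [JordanDecomposition.real_smul_posPart_nonneg _ _ hc,
      JordanDecomposition.real_smul_negPart_nonneg _ _ hc,
      integral_smul_nnreal_measure, integral_smul_nnreal_measure]
    simp only [NNReal.smul_def, Real.coe_toNNReal _ hc, smul_eq_mul]
    ring
  · rw [JordanDecomposition.real_smul_posPart_neg _ _ hc,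
      JordanDecomposition.real_smul_negPart_neg _ _ hc,
      integral_smul_nnreal_measure, integral_smul_nnreal_measure]
    simp only [NNReal.smul_def, Real.coe_toNNReal _ (neg_pos.2 hc).le, smul_eq_mul]
    ring

lemma sint_lin (a : SignedMeasure ℝ) {f g : ℝ → ℝ} (hf : BC f) (hg : BC g) (c : ℝ) :
    sint a (fun t => f t + c * g t) = sint a f + c * sint a g := by
  unfold sint
  rw [integral_add (hf.integrable _) ((hg.integrable _).const_mul c),
    integral_add (hf.integrable _) ((hg.integrable _).const_mul c),
    integral_const_mul, integral_const_mul]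
  ring

noncomputable def dd (τ : ℝ) : SignedMeasure ℝ :=
  (Measure.dirac τ).toSignedMeasure - (Measure.dirac (0:ℝ)).toSignedMeasure

lemma sint_pert (μ : SignedMeasure ℝ) (ε τ : ℝ) {f : ℝ → ℝ} (hf : BC f) :
    sint (μ + ε • dd τ) f = sint μ f + ε * (f τ - f 0) := by
  rw [sint_add _ _ hf, sint_smul, sint_of (dd τ) _ _ rfl hf, integral_dirac, integral_dirac]

lemma pos_null {T : ℝ} {μ : SignedMeasure ℝ}
    (hμ : ∀ s : Set ℝ, s ∩ Set.Icc 0 T = ∅ → μ s = 0) :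
    μ.toJordanDecomposition.posPart (Set.Icc 0 T)ᶜ = 0 ∧
    μ.toJordanDecomposition.negPart (Set.Icc 0 T)ᶜ = 0 := by
  obtain ⟨i, hi₁, hi₂, hi₃, hp, hn⟩ := μ.toJordanDecomposition_spec
  have hm : MeasurableSet (Set.Icc 0 T)ᶜ := measurableSet_Icc.compl
  rw [hp, hn, SignedMeasure.toMeasureOfZeroLE_apply _ _ _ hm,
    SignedMeasure.toMeasureOfLEZero_apply _ _ _ hm]
  have h1 : μ (i ∩ (Set.Icc 0 T)ᶜ) = 0 := hμ _ (by ext y; simp)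
  have h2 : μ (iᶜ ∩ (Set.Icc 0 T)ᶜ) = 0 := hμ _ (by ext y; simp)
  constructor
  · simp only [h1]; rfl
  · simp only [h2, neg_zero]; rfl

lemma sint_congr {T : ℝ} {μ : SignedMeasure ℝ}
    (hμ : ∀ s : Set ℝ, s ∩ Set.Icc 0 T = ∅ → μ s = 0) {f g : ℝ → ℝ}
    (hfg : ∀ t ∈ Set.Icc 0 T, f t = g t) : sint μ f = sint μ g := by
  obtain ⟨h1, h2⟩ := pos_null hμ
  have key : ∀ ρ : Measure ℝ, ρ (Set.Icc 0 T)ᶜ = 0 → ∫ t, f t ∂ρ = ∫ t, g t ∂ρ := by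
    intro ρ hρ
    apply integral_congr_ae
    have : ∀ᵐ t ∂ρ, t ∈ Set.Icc 0 T := hρ
    filter_upwards [this] with t ht using hfg t ht
  unfold sint
  rw [key _ h1, key _ h2]

lemma dd_supp {T τ : ℝ} (hT : 0 < T) (hτ : τ ∈ Set.Icc 0 T) (s : Set ℝ)
    (hs : s ∩ Set.Icc 0 T = ∅) : dd τ s = 0 := by
  by_cases hm : MeasurableSet s
  · have h1 : τ ∉ s := fun h => by
      have : τ ∈ s ∩ Set.Icc 0 T := ⟨h, hτ⟩
      simp [hs] at this
    have h2 : (0:ℝ) ∉ s := fun h => by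
      have : (0:ℝ) ∈ s ∩ Set.Icc 0 T := ⟨h, le_rfl, hT.le⟩
      simp [hs] at this
    rw [dd, Measure.toSignedMeasure_sub_apply hm]
    simp [measureReal_def, Measure.dirac_apply' _ hm, h1, h2]
  · exact VectorMeasure.not_measurable _ hm

lemma dd_univ (τ : ℝ) : dd τ Set.univ = 0 := by
  rw [dd, Measure.toSignedMeasure_sub_apply MeasurableSet.univ]
  simp

lemma dd_Ico {τ s : ℝ} (hτ : 0 ≤ τ) (hs : 0 < s) :
    dd τ (Set.Ico 0 s) = - (Set.Iic τ).indicator (fun _ => (1:ℝ)) s := by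
  rw [dd, Measure.toSignedMeasure_sub_apply measurableSet_Ico]
  by_cases h : s ≤ τ
  · simp [measureReal_def, h, hs, hτ, not_lt.2 h]
  · simp [measureReal_def, h, hs, hτ, not_le.1 h]

lemma inv_meas (μ : SignedMeasure ℝ) (x : ℝ) :
    Measurable (fun s => x + μ (Set.Ico 0 s)) ∧ ∃ M, ∀ s, |x + μ (Set.Ico 0 s)| ≤ M := by
  have e : ∀ s : ℝ, μ (Set.Ico 0 s) = μ.toJordanDecomposition.posPart.real (Set.Ico 0 s)
      - μ.toJordanDecomposition.negPart.real (Set.Ico 0 s) :=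
    fun s => μ.apply_eq_posPart_real_sub_negPart_real measurableSet_Ico
  have mono : ∀ ρ : Measure ℝ, IsFiniteMeasure ρ → Monotone (fun s : ℝ => ρ.real (Set.Ico 0 s)) :=
    fun ρ _ a b hab => measureReal_mono (Set.Ico_subset_Ico_right hab)
  constructor
  · simp only [e]
    exact measurable_const.add
      ((mono _ inferInstance).measurable.sub (mono _ inferInstance).measurable)
  · refine ⟨|x| + (μ.toJordanDecomposition.posPart.real Set.univ
      + μ.toJordanDecomposition.negPart.real Set.univ), fun s => ?_⟩
    refine (abs_add_le _ _).trans ?_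
    gcongr
    rw [e]
    have h1 : μ.toJordanDecomposition.posPart.real (Set.Ico 0 s)
        ≤ μ.toJordanDecomposition.posPart.real Set.univ := measureReal_mono (Set.subset_univ _)
    have h2 : μ.toJordanDecomposition.negPart.real (Set.Ico 0 s)
        ≤ μ.toJordanDecomposition.negPart.real Set.univ := measureReal_mono (Set.subset_univ _)
    have h3 : 0 ≤ μ.toJordanDecomposition.posPart.real (Set.Ico 0 s) := measureReal_nonneg
    have h4 : 0 ≤ μ.toJordanDecomposition.negPart.real (Set.Ico 0 s) := measureReal_nonneg
    rw [abs_le]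
    constructor <;> linarith

lemma risk_pert (μ : SignedMeasure ℝ) (x T τ ε : ℝ) (hT : 0 < T) (hτ : τ ∈ Set.Icc 0 T) :
    ∫ t in (0:ℝ)..T, (x + (μ + ε • dd τ) (Set.Ico 0 t))^2 =
      (∫ t in (0:ℝ)..T, (x + μ (Set.Ico 0 t))^2)
        - 2 * ε * (∫ t in (0:ℝ)..τ, (x + μ (Set.Ico 0 t))) + ε^2 * τ := by
  obtain ⟨hm, M, hM⟩ := inv_meas μ x
  set X : ℝ → ℝ := fun s => x + μ (Set.Ico 0 s) with hX
  have iX : ∀ a b, IntervalIntegrable X volume a b := fun a b => by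
    rw [intervalIntegrable_iff]
    have : IsFiniteMeasure (volume.restrict (Set.uIoc a b)) := ⟨by simp [Set.uIoc]⟩
    exact Integrable.of_bound hm.aestronglyMeasurable M (Filter.Eventually.of_forall hM)
  have iX2 : ∀ a b, IntervalIntegrable (fun t => X t ^ 2) volume a b := fun a b => by
    rw [intervalIntegrable_iff]
    have : IsFiniteMeasure (volume.restrict (Set.uIoc a b)) := ⟨by simp [Set.uIoc]⟩
    refine Integrable.of_bound (hm.pow_const 2).aestronglyMeasurable (M^2)
      (Filter.Eventually.of_forall fun t => ?_)
    rw [Real.norm_eq_abs, abs_pow]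
    exact pow_le_pow_left₀ (abs_nonneg _) (hM t) 2
  have e1 : ∀ t, 0 < t → x + (μ + ε • dd τ) (Set.Ico 0 t)
      = X t - ε * (Set.Iic τ).indicator (fun _ => (1:ℝ)) t := by
    intro t ht
    have := dd_Ico hτ.1 ht
    simp only [add_apply, smul_apply, this, hX, smul_eq_mul]
    ring
  have i3 : ∀ a b, IntervalIntegrable (fun t => (x + (μ + ε • dd τ) (Set.Ico 0 t))^2) volume a b := by
    obtain ⟨hm, M, hM⟩ := inv_meas (μ + ε • dd τ) x
    intro a b
    rw [intervalIntegrable_iff]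
    have : IsFiniteMeasure (volume.restrict (Set.uIoc a b)) := ⟨by simp [Set.uIoc]⟩
    refine Integrable.of_bound (hm.pow_const 2).aestronglyMeasurable (M^2)
      (Filter.Eventually.of_forall fun t => ?_)
    rw [Real.norm_eq_abs, abs_pow]
    exact pow_le_pow_left₀ (abs_nonneg _) (hM t) 2
  rw [← intervalIntegral.integral_add_adjacent_intervals (i3 0 τ) (i3 τ T),
    ← intervalIntegral.integral_add_adjacent_intervals (iX2 0 τ) (iX2 τ T)]
  have a1 : ∫ t in (0:ℝ)..τ, (x + (μ + ε • dd τ) (Set.Ico 0 t))^2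
      = ∫ t in (0:ℝ)..τ, (X t ^ 2 - 2 * ε * X t + ε ^ 2) := by
    apply intervalIntegral.integral_congr_ae
    refine Filter.Eventually.of_forall fun t ht => ?_
    rw [Set.uIoc_of_le hτ.1] at ht
    simp only [e1 t ht.1, Set.indicator, Set.mem_Iic, ht.2, if_true]
    ring
  have a2 : ∫ t in τ..T, (x + (μ + ε • dd τ) (Set.Ico 0 t))^2
      = ∫ t in τ..T, X t ^ 2 := by
    apply intervalIntegral.integral_congr_ae
    refine Filter.Eventually.of_forall fun t ht => ?_
    rw [Set.uIoc_of_le hτ.2] at ht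
    simp only [e1 t (hτ.1.trans_lt ht.1), Set.indicator, Set.mem_Iic, not_le.2 ht.1, if_false]
    ring
  rw [a1, a2, intervalIntegral.integral_add ((iX2 0 τ).sub ((iX 0 τ).const_mul _)) (by simp),
    intervalIntegral.integral_sub (iX2 0 τ) ((iX 0 τ).const_mul _),
    intervalIntegral.integral_const_mul]
  simp
  ring

/-- Necessity of the first-order condition: if `μ* ∈ Ξ(x)` minimizes the cost
functional over `Ξ(x)`, then there is a constant Lagrange multiplier `λ` such
that the optimality equation holds for all `t ∈ [0,T]`. -/
theorem stmt_3 (T x φ : ℝ) (hT : 0 < T) (hφ : 0 ≤ φ)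
    (h : ℝ → ℝ) (hh : IntegrableOn h (Set.Icc 0 T))
    (G : ℝ → ℝ)
    (hGnonneg : ∀ t, 0 ≤ t → 0 ≤ G t)
    (hGcont : ContinuousOn G (Set.Ici 0))
    (hGbdd : ∃ M : ℝ, ∀ t, 0 ≤ t → G t ≤ M)
    (hGspd : ∀ ν : SignedMeasure ℝ,
      (∀ s : Set ℝ, s ∩ Set.Icc 0 T = ∅ → ν s = 0) → ν ≠ 0 →
      0 < sint ν (fun t => sint ν (fun s => G |t - s|)))
    (C : SignedMeasure ℝ → ℝ)
    (hC : ∀ μ : SignedMeasure ℝ, C μ =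
      sint μ (fun t => ∫ s in (0:ℝ)..t, h s)
        + (1/2) * sint μ (fun t => sint μ (fun s => G |t - s|))
        + φ * ∫ t in (0:ℝ)..T, (x + μ (Set.Ico 0 t))^2)
    (μstar : SignedMeasure ℝ) (hμstar : μstar ∈ Xi T x)
    (hmin : ∀ μ ∈ Xi T x, C μstar ≤ C μ) :
    ∃ lam : ℝ, ∀ t ∈ Set.Icc (0:ℝ) T,
      (∫ s in (0:ℝ)..t, h s)
        + sint μstar (fun s => G |t - s|)
        - 2 * φ * ∫ s in (0:ℝ)..t, (x + μstar (Set.Ico 0 s)) = lam := by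
  obtain ⟨M, hM⟩ := hGbdd
  have cK : Continuous (fun u : ℝ => G |u|) :=
    hGcont.comp_continuous continuous_abs (fun u => abs_nonneg u)
  have bK : ∀ u : ℝ, |(G |u|)| ≤ M := fun u => by
    rw [abs_of_nonneg (hGnonneg _ (abs_nonneg _))]; exact hM _ (abs_nonneg _)
  have K1 : ∀ t : ℝ, BC (fun s => G |t - s|) := fun t =>
    ⟨cK.comp (continuous_const.sub continuous_id), M, fun s => bK _⟩
  have K2 : ∀ s : ℝ, BC (fun t => G |t - s|) := fun s =>
    ⟨cK.comp (continuous_id.sub continuous_const), M, fun s => bK _⟩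
  have sw : ∀ s, sint μstar (fun t => G |t - s|) = sint μstar (fun t => G |s - t|) := by
    intro s
    congr 1
    ext t
    rw [abs_sub_comm]
  have bg : BC (fun t => sint μstar (fun s => G |t - s|)) := by
    have cont : ∀ ρ : Measure ℝ, IsFiniteMeasure ρ → Continuous (fun t => ∫ s, G |t - s| ∂ρ) := by
      intro ρ _
      refine continuous_of_dominated (bound := fun _ => M) ?_ ?_ ?_ ?_
      · exact fun t => (K1 t).1.aestronglyMeasurable
      · exact fun t => Filter.Eventually.of_forall fun s => bK _
      · exact integrable_const _
      · exact Filter.Eventually.of_forall fun s => (K2 s).1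
    have bd : ∀ ρ : Measure ℝ, IsFiniteMeasure ρ → ∀ t, |(∫ s, G |t - s| ∂ρ)| ≤ M * ρ.real Set.univ := by
      intro ρ _ t
      rw [← Real.norm_eq_abs]
      exact norm_integral_le_of_norm_le_const (Filter.Eventually.of_forall fun s => bK (t - s))
    refine ⟨(cont _ inferInstance).sub (cont _ inferInstance), _, fun t =>
      (abs_sub _ _).trans (add_le_add (bd _ inferInstance t) (bd _ inferInstance t))⟩
  -- the signal term
  set h' : ℝ → ℝ := (Set.Icc 0 T).indicator h with hh'
  have ih' : Integrable h' := (integrable_indicator_iff measurableSet_Icc).2 hh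
  have bH : BC (fun t => ∫ s in (0:ℝ)..t, h' s) := by
    refine ⟨intervalIntegral.continuous_primitive (fun a b => ih'.intervalIntegrable) 0,
      ∫ s, |h' s|, fun t => ?_⟩
    change ‖∫ s in (0:ℝ)..t, h' s‖ ≤ ∫ s, ‖h' s‖
    refine (intervalIntegral.norm_integral_le_integral_norm_uIoc).trans ?_
    exact setIntegral_le_integral ih'.norm (Filter.Eventually.of_forall fun s => norm_nonneg _)
  have eH : ∀ t ∈ Set.Icc 0 T, ∫ s in (0:ℝ)..t, h s = ∫ s in (0:ℝ)..t, h' s := by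
    intro t ht
    apply intervalIntegral.integral_congr
    intro s hs
    rw [Set.uIcc_of_le ht.1] at hs
    simp [hh', Set.indicator, hs.1, hs.2.trans ht.2]
  refine ⟨sint μstar (fun s => G |0 - s|), fun τ hτ => ?_⟩
  have key : ∀ ε : ℝ, 0 ≤ ((1/2) * ((G |τ - τ| - G |τ - 0|) - (G |0 - τ| - G |0 - 0|)) + φ * τ)
      * (ε * ε) + ((∫ s in (0:ℝ)..τ, h s)
        + sint μstar (fun s => G |τ - s|) - sint μstar (fun s => G |0 - s|)
        - 2 * φ * ∫ s in (0:ℝ)..τ, (x + μstar (Set.Ico 0 s))) * ε + 0 := by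
    intro ε
    have supp : ∀ s : Set ℝ, s ∩ Set.Icc 0 T = ∅ → (μstar + ε • dd τ) s = 0 := by
      intro s hs
      simp [add_apply, hμstar.1 s hs, dd_supp hT hτ s hs]
    have mem : μstar + ε • dd τ ∈ Xi T x :=
      ⟨supp, by simp [add_apply, hμstar.2, dd_univ]⟩
    have h1 := hmin _ mem
    rw [hC, hC, risk_pert μstar x T τ ε hT hτ, sint_congr supp eH, sint_congr hμstar.1 eH,
      sint_pert _ _ _ bH, ← eH τ hτ] at h1
    have in1 : (fun t => sint (μstar + ε • dd τ) (fun s => G |t - s|))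
        = fun t => (sint μstar (fun s => G |t - s|) + ε * G |t - τ|) + (-ε) * G |t - 0| := by
      ext t
      rw [sint_pert _ _ _ (K1 t)]
      ring
    have b1 := bg.lin (K2 τ) ε
    have b2 := b1.lin (K2 0) (-ε)
    rw [in1, sint_pert _ _ _ b2, sint_lin _ b1 (K2 0), sint_lin _ bg (K2 τ), sw, sw,
      intervalIntegral.integral_same] at h1
    linarith
  have hd := discrim_le_zero key
  unfold discrim at hd
  have := pow_eq_zero_iff (two_ne_zero) |>.1 (le_antisymm (by linarith) (sq_nonneg ((∫ s in (0:ℝ)..τ, h s)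
        + sint μstar (fun s => G |τ - s|) - sint μstar (fun s => G |0 - s|)
        - 2 * φ * ∫ s in (0:ℝ)..τ, (x + μstar (Set.Ico 0 s)))))
  linarith
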